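/- Let V be a real vector space of dimension 4, g a nondegenerate symmetric bilinear form on V, u, n ∈ V with g(u,u) = −1, g(n,n) = 1, g(u,n) = 0, and let T be a symmetric bilinear form on V with 1+3 decomposition data (μ, p, q, π) with respect to u, i.e. T(v,w) = μ·g(u,v)·g(u,w) + p·h(v,w) + g(u,v)·q(w) + g(u,w)·q(v) + π(v,w), where q(u) = 0, π(u,·) = 0 and the g-trace of π is 0. Let Q(v) = v + g(u,v)·u − g(n,v)·n be the screen projection operator and P(v,w) = g(Q(v),w) the screen projection tensor. Then: (i) the heat flux splits as q(v) = ν·g(n,v) + 𝒬(v) for all v, where ν = q(n) and 𝒬 = q ∘ Q satisfies 𝒬(u) = 𝒬(n) = 0; and (ii) the anisotropic stress splits as π(v,w) = γ·(g(n,v)·g(n,w) − ½·P(v,w)) + g(n,v)·𝒫(w) + g(n,w)·𝒫(v) + D(v,w) for all v,w, where γ = π(n,n), 𝒫(v) = π(n, Q(v)), and D(v,w) = π(Q(v), Q(w)) + (γ/2)·P(v,w) is a symmetric bilinear form with D(u,·) = 0, D(n,·) = 0 and vanishing g-trace. -/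

import Mathlib

/-- The `g`-trace of a bilinear form `B` on `V`: the trace of the endomorphism obtained by
composing the map `v ↦ B v ·` with the inverse of the isomorphism `v ↦ g v ·` given by
nondegeneracy of `g`. -/
noncomputable def gTrace {V : Type*} [AddCommGroup V] [Module ℝ V] [FiniteDimensional ℝ V]
    (g : LinearMap.BilinForm ℝ V) (hg : LinearMap.BilinForm.Nondegenerate g)
    (B : LinearMap.BilinForm ℝ V) : ℝ :=
  LinearMap.trace ℝ V ((LinearMap.BilinForm.toDual g hg).symm.toLinearMap ∘ₗ B)

theorem gTrace_add {V : Type*} [AddCommGroup V] [Module ℝ V] [FiniteDimensional ℝ V]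
    (g : LinearMap.BilinForm ℝ V) (hg : LinearMap.BilinForm.Nondegenerate g)
    (A B : LinearMap.BilinForm ℝ V) :
    gTrace g hg (A + B) = gTrace g hg A + gTrace g hg B := by
  simp [gTrace, LinearMap.comp_add]

theorem gTrace_smul {V : Type*} [AddCommGroup V] [Module ℝ V] [FiniteDimensional ℝ V]
    (g : LinearMap.BilinForm ℝ V) (hg : LinearMap.BilinForm.Nondegenerate g)
    (c : ℝ) (B : LinearMap.BilinForm ℝ V) :
    gTrace g hg (c • B) = c * gTrace g hg B := by
  simp [gTrace, LinearMap.comp_smul]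

theorem gTrace_self {V : Type*} [AddCommGroup V] [Module ℝ V] [FiniteDimensional ℝ V]
    (g : LinearMap.BilinForm ℝ V) (hg : LinearMap.BilinForm.Nondegenerate g) :
    gTrace g hg g = Module.finrank ℝ V := by
  have h : (LinearMap.BilinForm.toDual g hg).symm.toLinearMap ∘ₗ g = LinearMap.id := by
    ext v
    exact (LinearMap.BilinForm.toDual g hg).symm_apply_apply v
  rw [gTrace, h, LinearMap.trace_id]

theorem gTrace_smulRight {V : Type*} [AddCommGroup V] [Module ℝ V] [FiniteDimensional ℝ V]
    (g : LinearMap.BilinForm ℝ V) (hg : LinearMap.BilinForm.Nondegenerate g)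
    (a b : V →ₗ[ℝ] ℝ) :
    gTrace g hg (a.smulRight b) = a ((LinearMap.BilinForm.toDual g hg).symm b) := by
  have h : (LinearMap.BilinForm.toDual g hg).symm.toLinearMap ∘ₗ a.smulRight b
      = a.smulRight ((LinearMap.BilinForm.toDual g hg).symm b) := by
    ext v
    simp
  rw [gTrace, h, LinearMap.trace_smulRight]

theorem gTrace_smulRight_right {V : Type*} [AddCommGroup V] [Module ℝ V]
    [FiniteDimensional ℝ V]
    (g : LinearMap.BilinForm ℝ V) (hg : LinearMap.BilinForm.Nondegenerate g)
    (a : V →ₗ[ℝ] ℝ) (x : V) :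
    gTrace g hg (a.smulRight (g x)) = a x := by
  rw [gTrace_smulRight]
  exact congrArg a ((LinearMap.BilinForm.toDual g hg).symm_apply_apply x)

theorem gTrace_smulRight_left {V : Type*} [AddCommGroup V] [Module ℝ V]
    [FiniteDimensional ℝ V]
    (g : LinearMap.BilinForm ℝ V) (hg : LinearMap.BilinForm.Nondegenerate g)
    (hsymm : ∀ v w : V, g v w = g w v) (a : V →ₗ[ℝ] ℝ) (x : V) :
    gTrace g hg ((g x).smulRight a) = a x := by
  rw [gTrace_smulRight, hsymm]
  exact LinearMap.congr_fun ((LinearMap.BilinForm.toDual g hg).apply_symm_apply a) x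

/-- Let `T` be a symmetric bilinear form with 1+3 decomposition data
`(μ, p, q, π)` with respect to `u`, and let `(u, n)` be an orthogonal double congruence
with screen projection operator `Q v = v + g u v • u − g n v • n` and screen projection
tensor `P v w = g (Q v) w`. Then (i) the heat flux splits as `q v = ν g n v + 𝒬 v` with
`ν = q n`, `𝒬 = q ∘ Q`, `𝒬 u = 𝒬 n = 0`; (ii) the anisotropic stress splits as
`π v w = γ (g n v * g n w − ½ P v w) + g n v * 𝒫 w + g n w * 𝒫 v + D v w` with
`γ = π n n`, `𝒫 v = π n (Q v)`, `D v w = π (Q v) (Q w) + (γ/2) P v w`, where `D` is a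
symmetric bilinear form with `D u · = 0`, `D n · = 0` and vanishing `g`-trace. -/
theorem one_one_two_decomposition_of_energy_momentum {V : Type*} [AddCommGroup V]
    [Module ℝ V] [FiniteDimensional ℝ V] (hdim : Module.finrank ℝ V = 4)
    (g : LinearMap.BilinForm ℝ V) (hg : LinearMap.BilinForm.Nondegenerate g)
    (hsymm : ∀ v w : V, g v w = g w v)
    (u n : V) (hu : g u u = -1) (hn : g n n = 1) (hun : g u n = 0)
    (μ p : ℝ) (q : V →ₗ[ℝ] ℝ) (π : LinearMap.BilinForm ℝ V)
    (hq : q u = 0) (hπu : ∀ w : V, π u w = 0)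
    (hπsymm : ∀ v w : V, π v w = π w v) (hπtr : gTrace g hg π = 0)
    (T : LinearMap.BilinForm ℝ V) (hT : ∀ v w : V, T v w = T w v)
    (hTdecomp : ∀ v w : V,
      T v w = μ * (g u v * g u w) + p * (g v w + g u v * g u w)
        + g u v * q w + g u w * q v + π v w) :
    let Q : V →ₗ[ℝ] V := LinearMap.id + (g u).smulRight u - (g n).smulRight n
    let P : LinearMap.BilinForm ℝ V := g.compl₁₂ Q LinearMap.id
    let D : LinearMap.BilinForm ℝ V := π.compl₁₂ Q Q + (π n n / 2) • P
    (∀ v : V, q v = q n * g n v + q (Q v)) ∧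
    q (Q u) = 0 ∧ q (Q n) = 0 ∧
    (∀ v w : V,
      π v w = π n n * (g n v * g n w - (1/2) * P v w)
        + g n v * π n (Q w) + g n w * π n (Q v) + D v w) ∧
    (∀ v w : V, D v w = D w v) ∧
    (∀ w : V, D u w = 0) ∧
    (∀ w : V, D n w = 0) ∧
    gTrace g hg D = 0 := by
  intro Q P D
  have hnu : g n u = 0 := (hsymm n u).trans hun
  have hπu' : ∀ w, π w u = 0 := fun w => (hπsymm w u).trans (hπu w)
  have hQ : ∀ v, Q v = v + g u v • u - g n v • n := fun v => rfl
  have hP : ∀ v w, P v w = g v w + g u v * g u w - g n v * g n w := fun v w => by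
    change g (Q v) w = _
    simp [hQ]
  have hD : ∀ v w, D v w = π (Q v) (Q w) + π n n / 2 * P v w := fun v w => rfl
  have hQu : Q u = 0 := by simp [hQ, hu, hnu]
  have hQn : Q n = 0 := by simp [hQ, hn, hun]
  have hπQ : ∀ v w, π (Q v) (Q w)
      = π v w - g n v * π n w - g n w * π n v + g n v * g n w * π n n := fun v w => by
    simp only [hQ, map_add, map_sub, map_smul, LinearMap.add_apply, LinearMap.sub_apply,
      LinearMap.smul_apply, smul_eq_mul, hπu, hπu', hπsymm v n]
    ring
  have hπnQ : ∀ v, π n (Q v) = π n v - g n v * π n n := fun v => by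
    simp [hQ, hπu']
  refine ⟨fun v => ?_, by simp [hQu], by simp [hQn], fun v w => ?_, fun v w => ?_,
    fun w => ?_, fun w => ?_, ?_⟩
  · simp only [hQ, map_add, map_sub, map_smul, smul_eq_mul, hq]
    ring
  · rw [hD, hπQ, hπnQ, hπnQ]
    ring
  · rw [hD, hD, hP, hP, hπsymm (Q v), hsymm v w]
    ring
  · simp [hD, hP, hQu, hu, hnu]
  · simp [hD, hP, hQn, hn, hun]
  · have hDsum : D = π + (π n n / 2) • g + (π n n / 2) • (g u).smulRight (g u)
        + (π n n / 2) • (g n).smulRight (g n)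
        + (-1 : ℝ) • (g n).smulRight (π n) + (-1 : ℝ) • (π n).smulRight (g n) := by
      ext v w
      rw [hD, hπQ, hP]
      simp only [LinearMap.add_apply, LinearMap.smul_apply, LinearMap.smulRight_apply,
        smul_eq_mul]
      ring
    rw [hDsum]
    simp only [gTrace_add, gTrace_smul, hπtr, gTrace_self, hdim, gTrace_smulRight_right,
      gTrace_smulRight_left g hg hsymm, hu, hn]
    push_cast
    ring
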